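/- Let $h$, $a$, $b$ be positive integers with $b \cdot h \le a^{h-1}$. Then there exist a commutative group $G$ and finite sets $A$, $B$ in $G$ such that $|A| = a^h + b$, $|A + B| \le a^h + b\, h\, a$, and $|A + hB| \ge (b+1)\, a^h$. -/

import Mathlib

open Pointwise

/-- `iterSum B k` is the `k`-fold iterated sumset `B + ⋯ + B` (`k` times),
with the convention `iterSum B 0 = {0}`. -/
def iterSum {G : Type*} [AddCommGroup G] [DecidableEq G] (B : Finset G) : ℕ → Finset G
  | 0 => {0}
  | k + 1 => iterSum B k + B

/-- A sum of `n` elements of `B` lies in the `n`-fold iterated sumset of `B`. -/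
theorem sum_mem_iterSum {G : Type*} [AddCommGroup G] [DecidableEq G] (B : Finset G) :
    ∀ (n : ℕ) (f : Fin n → G), (∀ i, f i ∈ B) → ∑ i, f i ∈ iterSum B n
  | 0, _, _ => by simp [iterSum]
  | n + 1, f, hf => by
    rw [Fin.sum_univ_castSucc]
    exact Finset.add_mem_add (sum_mem_iterSum B n _ fun i => hf i.castSucc) (hf (Fin.last n))

/-- The union of the `h` coordinate axes of `(ZMod a) ^ h`, placed at height `0` in
`(ZMod a) ^ h × K`. -/
def coordAxes (h a : ℕ) [NeZero a] (K : Type) [AddCommGroup K] [DecidableEq K] :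
    Finset ((Fin h → ZMod a) × K) :=
  (Finset.univ : Finset (Fin h × ZMod a)).image fun p => (Pi.single p.1 p.2, 0)

theorem card_coordAxes_le (h a : ℕ) [NeZero a] (K : Type) [AddCommGroup K] [DecidableEq K] :
    (coordAxes h a K).card ≤ h * a :=
  Finset.card_image_le.trans_eq (by simp [ZMod.card])

theorem mem_iterSum_coordAxes {h a : ℕ} [NeZero a] {K : Type} [AddCommGroup K] [DecidableEq K]
    (x : Fin h → ZMod a) : (x, (0 : K)) ∈ iterSum (coordAxes h a K) h := by
  have hx : ∑ i, ((Pi.single i (x i), 0) : (Fin h → ZMod a) × K) = (x, 0) := by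
    ext1
    · simp [Prod.fst_sum, Finset.univ_sum_single]
    · simp [Prod.snd_sum]
  rw [← hx]
  exact sum_mem_iterSum _ h _ fun i =>
    Finset.mem_image.2 ⟨(i, x i), Finset.mem_univ _, rfl⟩

/-- Ruzsa-type lower bound construction for `α` close to one: for positive integers
`h`, `a`, `b` with `b h ≤ a^(h-1)` there are finite sets `A`, `B` in a commutative
group with `|A| = a^h + b`, `|A + B| ≤ a^h + b h a` and `|A + hB| ≥ (b+1) a^h`. -/
theorem stmt_19 (h a b : ℕ) (hh : 0 < h) (ha : 0 < a) (hb : 0 < b)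
    (hba : b * h ≤ a ^ (h - 1)) :
    ∃ (G : Type) (_ : AddCommGroup G) (_ : DecidableEq G) (A B : Finset G),
      A.card = a ^ h + b ∧
      (A + B).card ≤ a ^ h + b * h * a ∧
      (b + 1) * a ^ h ≤ (A + iterSum B h).card := by
  have : NeZero a := ⟨ha.ne'⟩
  let H := Fin h → ZMod a
  let K := ZMod (b + 1)
  let A₁ : Finset (H × K) := Finset.univ ×ˢ {0}
  let A₂ : Finset (H × K) := {0} ×ˢ Finset.univ.erase 0
  let B : Finset (H × K) := coordAxes h a K
  have hA₁ : A₁.card = a ^ h := by simp [A₁, H, ZMod.card]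
  have hA₂ : A₂.card = b := by simp [A₂, K, ZMod.card]
  refine ⟨H × K, inferInstance, inferInstance, A₁ ∪ A₂, B, ?_, ?_, ?_⟩
  · rw [Finset.card_union_of_disjoint, hA₁, hA₂]
    rw [Finset.disjoint_left]
    rintro ⟨x, k⟩ h₁ h₂
    simp only [A₁, A₂, Finset.mem_product, Finset.mem_singleton, Finset.mem_erase] at h₁ h₂
    exact h₂.2.1 h₁.2
  · have hsub : A₁ + B ⊆ A₁ := by
      intro z hz
      obtain ⟨y, hy, w, hw, rfl⟩ := Finset.mem_add.1 hz
      obtain ⟨p, -, rfl⟩ := Finset.mem_image.1 hw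
      simp_all only [A₁, Finset.mem_product, Finset.mem_univ, Finset.mem_singleton, Prod.snd_add,
        add_zero, and_self]
    calc ((A₁ ∪ A₂) + B).card ≤ (A₁ + B).card + (A₂ + B).card := by
          rw [Finset.union_add]; exact Finset.card_union_le _ _
      _ ≤ A₁.card + A₂.card * B.card :=
          add_le_add (Finset.card_le_card hsub) Finset.card_add_le
      _ ≤ a ^ h + b * h * a := by
          rw [hA₁, hA₂, mul_assoc]
          gcongr
          exact card_coordAxes_le h a K
  · have huniv : (A₁ ∪ A₂) + iterSum B h = Finset.univ := by
      refine Finset.eq_univ_of_forall fun ⟨x, k⟩ => Finset.mem_add.2 ?_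
      by_cases hk : k = 0
      · exact ⟨(x, 0), by simp [A₁], (0, 0), mem_iterSum_coordAxes 0, by simp [hk]⟩
      · exact ⟨(0, k), by simp [A₂, hk], (x, 0), mem_iterSum_coordAxes x, by simp⟩
    rw [huniv]
    simp [H, K, ZMod.card, mul_comm]
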